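/- The cubic surfaces x₁²x₂ + x₁x₃x₄ + x₃³ and x₁x₂² + x₃x₄² are not in the same PGL(4,ℂ)-orbit; indeed their orbit closures have dimensions 13 and 14 respectively, and a projective change of coordinates would have to map the singular line [0:x₂:0:x₄] of the first to the singular line [x₁:0:x₃:0] of the second while preserving the surface, which is impossible since the Waring ranks (7 and 6) differ. -/

import Mathlib

open MvPolynomial Filter Topology

/-- The linear form `∑ i, cᵢ xᵢ`. -/
noncomputable def linForm {n : ℕ} (c : Fin n → ℂ) : MvPolynomial (Fin n) ℂ :=
  ∑ i, C (c i) * X i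

/-- The substitution of the linear forms `xᵢ ↦ ∑ j, g i j • xⱼ` into a polynomial,
i.e. the linear change of coordinates with matrix `g`. -/
noncomputable def substMat {n : ℕ} (g : Matrix (Fin n) (Fin n) ℂ) :
    MvPolynomial (Fin n) ℂ →ₐ[ℂ] MvPolynomial (Fin n) ℂ :=
  aeval fun i => ∑ j, C (g i j) * X j

/-- The orbit of `f` under `GL(n, ℂ)` acting by linear change of coordinates. -/
noncomputable def orbitSet {n : ℕ} (f : MvPolynomial (Fin n) ℂ) :
    Set (MvPolynomial (Fin n) ℂ) :=
  {p | ∃ g : Matrix (Fin n) (Fin n) ℂ, IsUnit g.det ∧ p = substMat g f}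

/-- The coefficient function of a polynomial; convergence of the coefficient functions
in the product topology is exactly coefficient-wise convergence. -/
noncomputable def coeffFn {n : ℕ} (f : MvPolynomial (Fin n) ℂ) : (Fin n →₀ ℕ) → ℂ :=
  fun m => coeff m f

/-- The Zariski topology on affine space `σ → ℂ`. -/
noncomputable def zariskiTop (σ : Type*) : TopologicalSpace (σ → ℂ) :=
  TopologicalSpace.generateFrom
    {U | ∃ f : MvPolynomial σ ℂ, U = {x | MvPolynomial.eval x f ≠ 0}}

/-- The Waring rank of a homogeneous cubic in four variables: the minimal `r` such
that it is a sum of `r` cubes of linear forms. -/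
noncomputable def waringRank (f : MvPolynomial (Fin 4) ℂ) : ℕ :=
  sInf {r | ∃ l : Fin r → (Fin 4 → ℂ), f = ∑ i, linForm (l i) ^ 3}


theorem ringKrullDim_eq_of_integral_inj {R S : Type*} [CommRing R] [CommRing S] [Algebra R S]
    [Algebra.IsIntegral R S] [FaithfulSMul R S] : ringKrullDim S = ringKrullDim R := by
  apply le_antisymm
  · refine Order.krullDim_le_of_strictMono (PrimeSpectrum.comap (algebraMap R S)) ?_
    intro I J h
    exact Ideal.IsIntegral.comap_lt_comap (R := R) (show I.asIdeal < J.asIdeal from h)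
  · unfold ringKrullDim
    refine iSup_le fun l => ?_
    obtain ⟨P, hP⟩ := Algebra.IsIntegral.comap_surjective R S
      l.head
    have : P.asIdeal.LiesOver l.head.asIdeal := ⟨by rw [← hP]; rfl⟩
    obtain ⟨L, hL, -⟩ := Ideal.exists_ltSeries_of_hasGoingUp l P.asIdeal
    rw [← hL]
    exact Order.LTSeries.length_le_krullDim L

theorem ringKrullDim_eq_of_trdeg {A : Type} [CommRing A] [IsDomain A] [Algebra ℂ A]
    [Algebra.FiniteType ℂ A] (k : ℕ) (h : Algebra.trdeg ℂ A = k) : ringKrullDim A = k := by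
  obtain ⟨s, g, hinj, hintegral⟩ := exists_integral_inj_algHom_of_fg ℂ A
  have hai : AlgebraicIndependent ℂ (fun i => g (X i)) := by
    have : (aeval (R := ℂ) fun i => g (X i)) = g := by ext; simp
    rw [AlgebraicIndependent, this]; exact hinj
  have htb : IsTranscendenceBasis ℂ (fun i => g (X i)) := by
    rw [hai.isTranscendenceBasis_iff_isAlgebraic]
    refine ⟨fun a => ?_⟩
    have hr : Algebra.adjoin ℂ (Set.range fun i => g (X i)) = g.range := by
      rw [Algebra.adjoin_range_eq_range_aeval]
      congr 1; ext; simp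
    rw [hr]
    obtain ⟨p, hp, hp0⟩ := hintegral a
    refine (IsIntegral.isAlgebraic (R := g.range) ⟨p.map g.rangeRestrict.toRingHom, hp.map _, ?_⟩)
    rw [Polynomial.eval₂_map]
    exact hp0
  have hs : (s : Cardinal) = k := by
    rw [← h, ← htb.cardinalMk_eq_trdeg]; simp
  have hs : s = k := by exact_mod_cast hs
  let _ := g.toRingHom.toAlgebra
  have : Algebra.IsIntegral (MvPolynomial (Fin s) ℂ) A := ⟨hintegral⟩
  have : FaithfulSMul (MvPolynomial (Fin s) ℂ) A := (faithfulSMul_iff_algebraMap_injective _ _).2 hinj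
  rw [ringKrullDim_eq_of_integral_inj (R := MvPolynomial (Fin s) ℂ)]
  simp [hs]

theorem topDim_eq_ringKrullDim {X A : Type*} [TopologicalSpace X] [CommRing A] [IsJacobsonRing A]
    (j : X → PrimeSpectrum A) (hj : IsInducing j) (hr : closedPoints (PrimeSpectrum A) ⊆ Set.range j) :
    topologicalKrullDim X = ringKrullDim A := by
  rw [← PrimeSpectrum.topologicalKrullDim_eq_ringKrullDim]
  refine le_antisymm hj.topologicalKrullDim_le ?_
  have key : ∀ Z : Set (PrimeSpectrum A), IsClosed Z → closure (j '' (j ⁻¹' Z)) = Z := by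
    intro Z hZ
    apply subset_antisymm
    · exact hZ.closure_subset_iff.2 (Set.image_preimage_subset _ _)
    · conv_lhs => rw [← JacobsonSpace.closure_inter_closedPoints hZ]
      apply closure_mono
      rintro z ⟨hz, hz'⟩
      obtain ⟨x, rfl⟩ := hr hz'
      exact ⟨x, hz, rfl⟩
  have irr : ∀ Z : Set (PrimeSpectrum A), IsClosed Z → IsIrreducible Z → IsIrreducible (j ⁻¹' Z) := by
    intro Z hZ hirr
    have h1 : IsIrreducible (j '' (j ⁻¹' Z)) := by
      rw [← isIrreducible_iff_closure, key Z hZ]; exact hirr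
    refine ⟨h1.nonempty.of_image, ?_⟩
    intro u v hu hv hu' hv'
    obtain ⟨u', hu1, rfl⟩ := hj.isOpen_iff.1 hu
    obtain ⟨v', hv1, rfl⟩ := hj.isOpen_iff.1 hv
    obtain ⟨a, ha, ha'⟩ := hu'
    obtain ⟨b, hb, hb'⟩ := hv'
    obtain ⟨_, ⟨y, hy, rfl⟩, hy1, hy2⟩ := h1.2 u' v' hu1 hv1 ⟨j a, ⟨a, ha, rfl⟩, ha'⟩ ⟨j b, ⟨b, hb, rfl⟩, hb'⟩
    exact ⟨y, hy, hy1, hy2⟩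
  refine Order.krullDim_le_of_strictMono
    (fun Z => ⟨j ⁻¹' Z.carrier, irr _ Z.isClosed' Z.isIrreducible', Z.isClosed'.preimage hj.continuous⟩) ?_
  refine Monotone.strictMono_of_injective ?_ ?_
  · intro Z W h
    exact Set.preimage_mono (f := j) h
  · intro Z W h
    have h' : j ⁻¹' Z.carrier = j ⁻¹' W.carrier := congrArg TopologicalSpace.IrreducibleCloseds.carrier h
    apply TopologicalSpace.IrreducibleCloseds.ext
    have := key _ Z.isClosed'
    rw [h', key _ W.isClosed'] at this
    exact this.symm

theorem zariski_basis (σ : Type*) :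
    @TopologicalSpace.IsTopologicalBasis _ (zariskiTop σ)
      {U | ∃ f : MvPolynomial σ ℂ, U = {x | MvPolynomial.eval x f ≠ 0}} := by
  let _ := zariskiTop σ
  refine ⟨?_, ?_, rfl⟩
  · rintro _ ⟨f, rfl⟩ _ ⟨g, rfl⟩ x ⟨hx, hx'⟩
    exact ⟨_, ⟨f * g, rfl⟩, by simpa using ⟨hx, hx'⟩, fun y hy => by simpa using hy⟩
  · rw [Set.sUnion_eq_univ_iff]
    intro x
    exact ⟨_, ⟨1, rfl⟩, by simp⟩

theorem mem_zclosure_iff {σ : Type*} (S : Set (σ → ℂ)) (x : σ → ℂ) :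
    x ∈ @closure _ (zariskiTop σ) S ↔
      ∀ F : MvPolynomial σ ℂ, (∀ s ∈ S, eval s F = 0) → eval x F = 0 := by
  let _ := zariskiTop σ
  rw [(zariski_basis σ).mem_closure_iff]
  constructor
  · intro h F hF
    by_contra hx
    obtain ⟨y, hy, hy'⟩ := h _ ⟨F, rfl⟩ hx
    exact hy (hF y hy')
  · rintro h _ ⟨F, rfl⟩ hx
    by_contra hne
    refine hx (h F fun s hs => ?_)
    by_contra hs'
    exact hne ⟨s, hs', hs⟩

theorem dim_param {σ : Type} {k : ℕ} (c : σ → MvPolynomial (Fin k) ℂ) (hfin : (Set.range c).Finite)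
    (htr : Algebra.trdeg ℂ (Algebra.adjoin ℂ (Set.range c)) = k) :
    letI := zariskiTop σ
    topologicalKrullDim ↥(closure (Set.range fun p : Fin k → ℂ => fun m => eval p (c m))) = (k : ℕ∞) := by
  letI := zariskiTop σ
  let φ : MvPolynomial σ ℂ →ₐ[ℂ] MvPolynomial (Fin k) ℂ := aeval c
  have hφ : ∀ F p, eval p (φ F) = eval (fun m => eval p (c m)) F := by
    intro F p
    have : (eval p).comp φ.toRingHom = eval (fun m => eval p (c m)) := by
      ext <;> simp [φ]
    exact RingHom.congr_fun this F
  have hmem : ∀ x, x ∈ closure (Set.range fun p : Fin k → ℂ => fun m => eval p (c m)) ↔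
      ∀ F, φ F = 0 → eval x F = 0 := by
    intro x
    rw [mem_zclosure_iff]
    refine forall_congr' fun F => ?_
    refine imp_congr_left ?_
    constructor
    · intro h
      apply MvPolynomial.funext
      intro p
      rw [hφ, h _ ⟨p, rfl⟩, map_zero]
    · rintro h _ ⟨p, rfl⟩
      rw [← hφ, h, map_zero]
  set V := closure (Set.range fun p : Fin k → ℂ => fun m => eval p (c m)) with hV
  let I : Ideal (MvPolynomial σ ℂ) := RingHom.ker φ
  have hI : ∀ F, F ∈ I ↔ φ F = 0 := fun F => RingHom.mem_ker
  have eqv : (MvPolynomial σ ℂ ⧸ I) ≃ₐ[ℂ] Algebra.adjoin ℂ (Set.range c) :=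
    (Ideal.quotientKerEquivRange φ).trans
      (Subalgebra.equivOfEq _ _ (Algebra.adjoin_range_eq_range_aeval ℂ c).symm)
  have hft : Algebra.FiniteType ℂ (Algebra.adjoin ℂ (Set.range c)) := by
    rw [← Subalgebra.fg_iff_finiteType]
    exact Subalgebra.fg_def.2 ⟨_, hfin, rfl⟩
  have hftA : Algebra.FiniteType ℂ (MvPolynomial σ ℂ ⧸ I) := hft.equiv eqv.symm
  have hdom : IsDomain (MvPolynomial σ ℂ ⧸ I) := by
    have := RingHom.ker_isPrime φ.toRingHom
    exact (Ideal.Quotient.isDomain_iff_prime I).2 this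
  have hdim : ringKrullDim (MvPolynomial σ ℂ ⧸ I) = k := by
    apply ringKrullDim_eq_of_trdeg
    rw [eqv.trdeg_eq, htr]
  have hJ : IsJacobsonRing (MvPolynomial σ ℂ ⧸ I) := isJacobsonRing_of_finiteType (A := ℂ)
  let e : V → (MvPolynomial σ ℂ ⧸ I) →+* ℂ := fun x =>
    Ideal.Quotient.lift I (eval x.1) (fun F hF => (hmem x.1).1 x.2 F ((hI F).1 hF))
  have he : ∀ x F, e x (Ideal.Quotient.mk I F) = eval x.1 F := fun x F => rfl
  let j : V → PrimeSpectrum (MvPolynomial σ ℂ ⧸ I) := fun x => ⟨RingHom.ker (e x), RingHom.ker_isPrime _⟩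
  have hjb : ∀ F, j ⁻¹' (PrimeSpectrum.basicOpen (Ideal.Quotient.mk I F)) =
      Subtype.val ⁻¹' {x : σ → ℂ | eval x F ≠ 0} := by
    intro F
    ext x
    simp only [Set.mem_preimage, SetLike.mem_coe, PrimeSpectrum.mem_basicOpen, Set.mem_ofPred_eq, j,
      RingHom.mem_ker, he, ne_eq]
  have hjind : IsInducing j := by
    constructor
    have h1 := (PrimeSpectrum.isTopologicalBasis_basic_opens
      (R := MvPolynomial σ ℂ ⧸ I)).eq_generateFrom
    rw [h1, induced_generateFrom_eq]
    have h2 : (instTopologicalSpaceSubtype : TopologicalSpace V) =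
      TopologicalSpace.induced Subtype.val (zariskiTop σ) := rfl
    rw [h2, zariskiTop, induced_generateFrom_eq]
    congr 1
    ext U
    constructor
    · rintro ⟨_, ⟨F, rfl⟩, rfl⟩
      exact ⟨_, ⟨Ideal.Quotient.mk I F, rfl⟩, hjb F⟩
    · rintro ⟨_, ⟨a, rfl⟩, rfl⟩
      obtain ⟨F, rfl⟩ := Ideal.Quotient.mk_surjective a
      exact ⟨_, ⟨F, rfl⟩, (hjb F).symm⟩
  have := topDim_eq_ringKrullDim j hjind ?_
  · rw [this, hdim]; rfl
  intro P hP
  rw [mem_closedPoints_iff, PrimeSpectrum.isClosed_singleton_iff_isMaximal] at hP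
  let fl : Field ((MvPolynomial σ ℂ ⧸ I) ⧸ P.asIdeal) := Ideal.Quotient.field _
  have hf1 : Algebra.FiniteType ℂ ((MvPolynomial σ ℂ ⧸ I) ⧸ P.asIdeal) :=
    Algebra.FiniteType.of_surjective (Ideal.Quotient.mkₐ ℂ P.asIdeal) (Ideal.Quotient.mkₐ_surjective _ _)
  have hf2 : Module.Finite ℂ ((MvPolynomial σ ℂ ⧸ I) ⧸ P.asIdeal) :=
    finite_of_finite_type_of_isJacobsonRing _ _
  have hb : Function.Bijective (algebraMap ℂ ((MvPolynomial σ ℂ ⧸ I) ⧸ P.asIdeal)) :=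
    IsAlgClosed.algebraMap_bijective_of_isIntegral
  let ee := (AlgEquiv.ofBijective (Algebra.ofId ℂ ((MvPolynomial σ ℂ ⧸ I) ⧸ P.asIdeal)) hb).symm
  let ψ : MvPolynomial σ ℂ →ₐ[ℂ] ℂ := (ee.toAlgHom.comp (Ideal.Quotient.mkₐ ℂ P.asIdeal)).comp
    (Ideal.Quotient.mkₐ ℂ I)
  have hψ : ∀ F, ψ F = 0 ↔ Ideal.Quotient.mk I F ∈ P.asIdeal := by
    intro F
    rw [← Ideal.Quotient.eq_zero_iff_mem]
    exact map_eq_zero_iff ee ee.injective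
  have hψe : ∀ F, eval (fun m => ψ (X m)) F = ψ F := by
    intro F
    have : aeval (fun m => ψ (X m)) = ψ := by ext; simp
    have h2 := AlgHom.congr_fun this F
    rw [← h2, MvPolynomial.aeval_eq_eval]
  refine ⟨⟨fun m => ψ (X m), (hmem _).2 fun F hF => ?_⟩, ?_⟩
  · rw [hψe, hψ, Ideal.Quotient.eq_zero_iff_mem.2 ((hI F).2 hF)]
    exact zero_mem _
  · ext a
    obtain ⟨F, rfl⟩ := Ideal.Quotient.mk_surjective a
    rw [← hψ, ← hψe]
    rfl

theorem pderiv_aeval_chain {k : ℕ} (F : Fin k → MvPolynomial (Fin k) ℂ) (j : Fin k)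
    (P : MvPolynomial (Fin k) ℂ) :
    pderiv j (aeval F P) = ∑ i, aeval F (pderiv i P) * pderiv j (F i) := by
  induction P using MvPolynomial.induction_on with
  | C a => simp [← algebraMap_eq]
  | add p q hp hq => simp only [map_add, hp, hq, add_mul, Finset.sum_add_distrib]
  | mul_X p n hp =>
    simp only [map_mul, aeval_X, Derivation.leibniz, hp, smul_eq_mul, map_add, add_mul,
      Finset.sum_add_distrib, pderiv_X, Finset.mul_sum]
    congr 1
    · rw [Finset.sum_eq_single n]
      · simp
      · intro b _ hb; simp [Pi.single_apply, hb.symm]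
      · simp
    · refine Finset.sum_congr rfl fun i _ => by ring

theorem algIndep_of_jac {k : ℕ} (F : Fin k → MvPolynomial (Fin k) ℂ) (d : Fin k → ℂ)
    (hd : ∀ i, d i ≠ 0)
    (hF : ∀ i j, eval 0 (pderiv j (F i)) = if i = j then d i else 0) :
    AlgebraicIndependent ℂ F := by
  rw [algebraicIndependent_iff]
  have key : ∀ (N : ℕ) (P : MvPolynomial (Fin k) ℂ), P.totalDegree ≤ N → aeval F P = 0 → P = 0 := by
    intro N
    induction N with
    | zero =>
      intro P hP h
      have hc := totalDegree_eq_zero_iff_eq_C.1 (Nat.le_zero.1 hP)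
      rw [hc, aeval_C, algebraMap_eq, C_eq_zero] at h
      rw [hc, h, C_0]
    | succ N ih =>
      intro P hP h
      let J : Matrix (Fin k) (Fin k) (MvPolynomial (Fin k) ℂ) := Matrix.of fun i j => pderiv j (F i)
      have hJ : J.det ≠ 0 := by
        intro h0
        have h1 := RingHom.map_det (eval (0 : Fin k → ℂ)) J
        rw [h0, map_zero] at h1
        have h2 : (eval (0 : Fin k → ℂ)).mapMatrix J = Matrix.diagonal d := by
          ext i j
          simpa [J, Matrix.diagonal_apply] using hF i j
        rw [h2, Matrix.det_diagonal] at h1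
        exact (Finset.prod_ne_zero_iff.2 fun i _ => hd i) h1.symm
      have hv : Matrix.vecMul (fun i => aeval F (pderiv i P)) J = 0 := by
        ext1 j
        have := pderiv_aeval_chain F j P
        rw [h, map_zero] at this
        simpa [Matrix.vecMul, dotProduct, J] using this.symm
      have hz := Matrix.eq_zero_of_vecMul_eq_zero hJ hv
      have hp : ∀ i, pderiv i P = 0 := by
        intro i
        refine ih _ ?_ (congrFun hz i)
        refine Finset.sup_le ?_
        intro m hm
        have : coeff m (pderiv i P) ≠ 0 := mem_support_iff.1 hm
        rw [coeff_pderiv] at this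
        have h3 := le_totalDegree (mem_support_iff.2 (left_ne_zero_of_mul this))
        rw [Finsupp.sum_add_index' (by simp) (by simp)] at h3
        simp at h3
        omega
      have hc : P = C (coeff 0 P) := by
        ext m
        rw [coeff_C]
        split_ifs with hm
        · rw [hm]
        · obtain ⟨i, hi⟩ : ∃ i, m i ≠ 0 := by
            by_contra hcon
            push Not at hcon
            exact hm (Finsupp.ext fun i => (hcon i).symm)
          have h4 : coeff (m - Finsupp.single i 1) (pderiv i P) = 0 := by rw [hp, coeff_zero]
          have h5 : m - Finsupp.single i 1 + Finsupp.single i 1 = m := by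
            apply tsub_add_cancel_of_le
            rw [Finsupp.single_le_iff]
            omega
          rw [coeff_pderiv, h5] at h4
          rcases mul_eq_zero.1 h4 with h6 | h6
          · exact h6
          · exfalso
            exact Nat.cast_add_one_ne_zero _ h6
      rw [hc, aeval_C, algebraMap_eq, C_eq_zero] at h
      rw [hc, h, C_0]
  exact fun P => key _ P le_rfl

theorem trdeg_adjoin_of_jac {σ : Type} {k : ℕ} (c : σ → MvPolynomial (Fin k) ℂ)
    (F : Fin k → MvPolynomial (Fin k) ℂ) (hFc : ∀ i, F i ∈ Algebra.adjoin ℂ (Set.range c))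
    (d : Fin k → ℂ) (hd : ∀ i, d i ≠ 0)
    (hF : ∀ i j, eval 0 (pderiv j (F i)) = if i = j then d i else 0) :
    Algebra.trdeg ℂ (Algebra.adjoin ℂ (Set.range c)) = k := by
  apply le_antisymm
  · have := trdeg_le_of_injective (Algebra.adjoin ℂ (Set.range c)).val Subtype.val_injective
    rw [MvPolynomial.trdeg_of_isDomain] at this
    simpa using this
  · let F' : Fin k → Algebra.adjoin ℂ (Set.range c) := fun i => ⟨F i, hFc i⟩
    have h1 : AlgebraicIndependent ℂ F' := by
      apply AlgebraicIndependent.of_comp (Algebra.adjoin ℂ (Set.range c)).val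
      exact algIndep_of_jac F d hd hF
    have := h1.cardinalMk_le_trdeg
    simpa using this

/-- Substitution of a matrix with polynomial entries. -/
noncomputable def genForm {τ : Type} (Γ : Matrix (Fin 4) (Fin 4) (MvPolynomial τ ℂ))
    (f : MvPolynomial (Fin 4) ℂ) : MvPolynomial (Fin 4) (MvPolynomial τ ℂ) :=
  eval₂Hom ((C : MvPolynomial τ ℂ →+* MvPolynomial (Fin 4) (MvPolynomial τ ℂ)).comp C)
    (fun i => ∑ j, C (Γ i j) * X j) f

theorem map_genForm {τ : Type} (Γ : Matrix (Fin 4) (Fin 4) (MvPolynomial τ ℂ))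
    (f : MvPolynomial (Fin 4) ℂ) (p : τ → ℂ) :
    MvPolynomial.map (eval p) (genForm Γ f) = substMat (Γ.map (eval p)) f := by
  have : (MvPolynomial.map (eval p)).comp (eval₂Hom
      ((C : MvPolynomial τ ℂ →+* MvPolynomial (Fin 4) (MvPolynomial τ ℂ)).comp C)
      (fun i => ∑ j, C (Γ i j) * X j)) = (substMat (Γ.map (eval p))).toRingHom := by
    apply MvPolynomial.ringHom_ext
    · intro r
      simp [substMat]
    · intro i
      simp [substMat]
  exact RingHom.congr_fun this f

theorem eval_coeff_genForm {τ : Type} (Γ : Matrix (Fin 4) (Fin 4) (MvPolynomial τ ℂ))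
    (f : MvPolynomial (Fin 4) ℂ) (p : τ → ℂ) (m : Fin 4 →₀ ℕ) :
    eval p (coeff m (genForm Γ f)) = coeff m (substMat (Γ.map (eval p)) f) := by
  rw [← map_genForm, coeff_map]

theorem eval_aeval_genForm {τ : Type} (Γ : Matrix (Fin 4) (Fin 4) (MvPolynomial τ ℂ))
    (f : MvPolynomial (Fin 4) ℂ) (p : τ → ℂ) (F : MvPolynomial (Fin 4 →₀ ℕ) ℂ) :
    eval p (aeval (fun m => coeff m (genForm Γ f)) F) =
      eval (coeffFn (substMat (Γ.map (eval p)) f)) F := by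
  have : (eval p).comp (aeval (R := ℂ) (fun m => coeff m (genForm Γ f))).toRingHom =
      eval (coeffFn (substMat (Γ.map (eval p)) f)) := by
    apply MvPolynomial.ringHom_ext
    · intro r; simp
    · intro m; simp [eval_coeff_genForm, coeffFn]
  exact RingHom.congr_fun this F

theorem closure_orbit_eq {τ : Type} (Γ : Matrix (Fin 4) (Fin 4) (MvPolynomial τ ℂ))
    (f : MvPolynomial (Fin 4) ℂ) (hΓ : Γ.map (eval 0) = 1)
    (h : MvPolynomial (Fin 4 × Fin 4) ℂ) (h0 : h ≠ 0)
    (hh : ∀ g : Matrix (Fin 4) (Fin 4) ℂ, eval (fun q => g q.1 q.2) h ≠ 0 →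
      ∃ p, substMat g f = substMat (Γ.map (eval p)) f) :
    @closure _ (zariskiTop _) (coeffFn '' orbitSet f) =
    @closure _ (zariskiTop _) (Set.range fun p : τ → ℂ => fun m => eval p (coeff m (genForm Γ f))) := by
  ext x
  rw [mem_zclosure_iff, mem_zclosure_iff]
  refine forall_congr' fun F => ?_
  refine imp_congr_left ?_
  have e1 : ∀ p : τ → ℂ, (fun m => eval p (coeff m (genForm Γ f))) =
      coeffFn (substMat (Γ.map (eval p)) f) := by
    intro p; funext m; rw [eval_coeff_genForm]; rfl
  constructor
  · rintro H _ ⟨p, rfl⟩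
    simp only [e1]
    rw [← eval_aeval_genForm]
    have hz : Γ.det * aeval (fun m => coeff m (genForm Γ f)) F = 0 := by
      apply MvPolynomial.funext
      intro q
      rw [map_mul, map_zero, eval_aeval_genForm, RingHom.map_det, RingHom.mapMatrix_apply]
      by_cases hd : (Γ.map (eval q)).det = 0
      · rw [hd, zero_mul]
      · rw [H _ ⟨_, ⟨_, isUnit_iff_ne_zero.2 hd, rfl⟩, rfl⟩, mul_zero]
    have hd0 : Γ.det ≠ 0 := by
      intro hd
      have := RingHom.map_det (eval (0 : τ → ℂ)) Γ
      rw [hd, map_zero, RingHom.mapMatrix_apply, hΓ, Matrix.det_one] at this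
      exact zero_ne_one this
    rw [(mul_eq_zero.1 hz).resolve_left hd0, map_zero]
  · rintro H _ ⟨_, ⟨g, -, rfl⟩, rfl⟩
    let Γ' : Matrix (Fin 4) (Fin 4) (MvPolynomial (Fin 4 × Fin 4) ℂ) := Matrix.of fun i j => X (i, j)
    have e2 : ∀ q : Fin 4 × Fin 4 → ℂ, Γ'.map (eval q) = Matrix.of fun i j => q (i, j) := by
      intro q; ext i j; simp [Γ']
    have hz : h * aeval (fun m => coeff m (genForm Γ' f)) F = 0 := by
      apply MvPolynomial.funext
      intro q
      rw [map_mul, map_zero, eval_aeval_genForm, e2]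
      by_cases hq : eval q h = 0
      · rw [hq, zero_mul]
      · obtain ⟨p, hp⟩ := hh (Matrix.of fun i j => q (i, j)) hq
        rw [hp, ← e1, H _ ⟨p, rfl⟩, mul_zero]
    have := eval_aeval_genForm Γ' f (fun q => g q.1 q.2) F
    rw [(mul_eq_zero.1 hz).resolve_left h0, map_zero, e2] at this
    exact this.symm

/-- First order data of a polynomial with polynomial coefficients. -/
def HasTan {k : ℕ} (j : Fin k) (G : MvPolynomial (Fin 4) (MvPolynomial (Fin k) ℂ))
    (A B : MvPolynomial (Fin 4) ℂ) : Prop :=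
  ∀ m, eval 0 (coeff m G) = coeff m A ∧ eval 0 (pderiv j (coeff m G)) = coeff m B

theorem HasTan.add {k : ℕ} {j : Fin k} {G G' : MvPolynomial (Fin 4) (MvPolynomial (Fin k) ℂ)}
    {A A' B B' : MvPolynomial (Fin 4) ℂ} (h : HasTan j G A B) (h' : HasTan j G' A' B') :
    HasTan j (G + G') (A + A') (B + B') := fun m => by
  simp only [coeff_add, map_add, (h m).1, (h m).2, (h' m).1, (h' m).2, and_self]

theorem HasTan.mul {k : ℕ} {j : Fin k} {G G' : MvPolynomial (Fin 4) (MvPolynomial (Fin k) ℂ)}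
    {A A' B B' : MvPolynomial (Fin 4) ℂ} (h : HasTan j G A B) (h' : HasTan j G' A' B') :
    HasTan j (G * G') (A * A') (B * A' + A * B') := fun m => by
  simp only [coeff_add, coeff_mul, map_sum, map_mul, Derivation.leibniz, smul_eq_mul, map_add,
    fun m => (h m).1, fun m => (h m).2, fun m => (h' m).1, fun m => (h' m).2, true_and,
    ← Finset.sum_add_distrib]
  exact Finset.sum_congr rfl fun i _ => by ring

/-- The affine slice of matrices, parametrised by positions `(r j, s j)`. -/
noncomputable def slice {k : ℕ} (r s : Fin k → Fin 4) :
    Matrix (Fin 4) (Fin 4) (MvPolynomial (Fin k) ℂ) :=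
  Matrix.of fun i l => C ((1 : Matrix (Fin 4) (Fin 4) ℂ) i l) +
    ∑ j, if i = r j ∧ l = s j then X j else 0

theorem slice_zero {k : ℕ} (r s : Fin k → Fin 4) : (slice r s).map (eval 0) = 1 := by
  ext i l
  simp only [slice, Matrix.map_apply, Matrix.of_apply, map_add, eval_C, map_sum, apply_ite (eval 0),
    eval_X, map_zero, Pi.zero_apply, ite_self, Finset.sum_const_zero, add_zero]

theorem slice_pderiv {k : ℕ} (r s : Fin k → Fin 4) (i l j) :
    eval 0 (pderiv j (slice r s i l)) = if i = r j ∧ l = s j then 1 else 0 := by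
  simp only [slice, Matrix.of_apply, map_add, pderiv_C, map_sum, apply_ite (pderiv j), pderiv_X,
    map_zero, zero_add, apply_ite (eval 0)]
  rw [Finset.sum_eq_single j]
  · simp
  · intro b _ hb; simp [hb.symm]
  · simp

theorem slice_surj {k : ℕ} (r s : Fin k → Fin 4) (hrs : Function.Injective fun j => (r j, s j))
    (M : Matrix (Fin 4) (Fin 4) ℂ)
    (hM : ∀ i l, (∀ j, (i, l) ≠ (r j, s j)) → M i l = (1 : Matrix (Fin 4) (Fin 4) ℂ) i l) :
    ∃ p : Fin k → ℂ, (slice r s).map (eval p) = M := by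
  refine ⟨fun j => M (r j) (s j) - (1 : Matrix (Fin 4) (Fin 4) ℂ) (r j) (s j), ?_⟩
  ext i l
  simp only [slice, Matrix.map_apply, Matrix.of_apply, map_add, eval_C, map_sum, apply_ite (eval _),
    eval_X, map_zero]
  by_cases h : ∃ j, (i, l) = (r j, s j)
  · obtain ⟨j, hj⟩ := h
    obtain ⟨rfl, rfl⟩ := Prod.mk.inj hj
    rw [Finset.sum_eq_single j]
    · simp
    · intro b _ hb
      rw [if_neg]
      rintro ⟨h1, h2⟩
      exact hb (hrs (Prod.ext h1.symm h2.symm))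
    · simp
  · push Not at h
    rw [hM i l h, Finset.sum_eq_zero, add_zero]
    intro j _
    rw [if_neg]
    rintro ⟨h1, h2⟩
    exact h j (Prod.ext h1 h2)

theorem hasTan_row {k : ℕ} (r s : Fin k → Fin 4) (j : Fin k) (i : Fin 4) :
    HasTan j (∑ l, C (slice r s i l) * X l) (X i) (if i = r j then X (s j) else 0) := by
  intro m
  have h0 : ∀ i l, eval 0 (slice r s i l) = (1 : Matrix (Fin 4) (Fin 4) ℂ) i l := by
    intro i l
    rw [← slice_zero r s]; rfl
  simp only [coeff_sum, coeff_C_mul, map_sum, map_mul, Derivation.leibniz, smul_eq_mul, map_add,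
    coeff_X, apply_ite (eval (0 : Fin k → ℂ)), apply_ite (pderiv j), map_one, map_zero, h0,
    slice_pderiv, Derivation.map_one_eq_zero, ite_self, mul_zero, zero_add]
  constructor
  · rw [Finset.sum_eq_single i]
    · simp
    · intro b _ hb; simp [Matrix.one_apply, hb.symm]
    · simp
  · rw [Finset.sum_eq_single (s j)]
    · by_cases hi : i = r j <;> simp [hi, coeff_X]
    · intro b _ hb; simp [hb]
    · simp

abbrev Tri := Fin 4 × Fin 4 × Fin 4

/-- Exponent counts of a cubic monomial. -/
def cnt (t : Tri) (i : Fin 4) : ℕ :=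
  (if t.1 = i then 1 else 0) + (if t.2.1 = i then 1 else 0) + (if t.2.2 = i then 1 else 0)

/-- Pairing of cubic monomials. -/
def pairing (m t : Tri) : ℤ := if ∀ i, cnt m i = cnt t i then 1 else 0

/-- The cubic monomial of a triple of indices. -/
noncomputable def triMon (t : Tri) : MvPolynomial (Fin 4) ℂ := X t.1 * X t.2.1 * X t.2.2

/-- The exponent vector of a triple of indices. -/
noncomputable def triExp (t : Tri) : Fin 4 →₀ ℕ :=
  Finsupp.single t.1 1 + Finsupp.single t.2.1 1 + Finsupp.single t.2.2 1

theorem triExp_apply (t : Tri) (i : Fin 4) : triExp t i = cnt t i := by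
  simp [triExp, cnt, Finsupp.single_apply]

theorem coeff_triMon (m t : Tri) : coeff (triExp m) (triMon t) = (pairing m t : ℂ) := by
  have : triMon t = monomial (triExp t) 1 := by
    simp only [triMon, triExp, X, monomial_mul, mul_one]
  rw [this, coeff_monomial, pairing]
  have h : triExp t = triExp m ↔ ∀ i, cnt m i = cnt t i := by
    rw [Finsupp.ext_iff]
    simp only [triExp_apply]
    exact forall_congr' fun i => eq_comm
  by_cases hc : ∀ i, cnt m i = cnt t i
  · rw [if_pos (h.2 hc), if_pos hc]; simp
  · rw [if_neg (fun h' => hc (h.1 h')), if_neg hc]; simp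

/-- The tangent coefficient of a monomial. -/
def tan1 (r s : Fin 4) (t m : Tri) : ℤ :=
  (if t.1 = r then pairing m (s, t.2.1, t.2.2) else 0) +
  (if t.2.1 = r then pairing m (t.1, s, t.2.2) else 0) +
  (if t.2.2 = r then pairing m (t.1, t.2.1, s) else 0)

theorem tan_triMon {k : ℕ} (r s : Fin k → Fin 4) (j : Fin k) (t m : Tri) :
    eval 0 (pderiv j (coeff (triExp m) (genForm (slice r s) (triMon t)))) =
      (tan1 (r j) (s j) t m : ℂ) := by
  have := ((hasTan_row r s j t.1).mul (hasTan_row r s j t.2.1)).mul (hasTan_row r s j t.2.2)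
  have e : genForm (slice r s) (triMon t) = (∑ l, C (slice r s t.1 l) * X l) *
     (∑ l, C (slice r s t.2.1 l) * X l) * (∑ l, C (slice r s t.2.2 l) * X l) := by
    simp [genForm, triMon]
  rw [e, (this (triExp m)).2, add_mul, coeff_add, coeff_add]
  simp only [tan1, Int.cast_add, ← coeff_triMon, apply_ite (Int.cast : ℤ → ℂ), Int.cast_zero]
  congr 1
  · congr 1
    · split_ifs <;> simp [triMon]
    · split_ifs <;> simp [triMon]
  · split_ifs <;> simp [triMon]

theorem genForm_list {τ : Type} (Γ : Matrix (Fin 4) (Fin 4) (MvPolynomial τ ℂ)) (L : List Tri) :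
    genForm Γ (L.map triMon).sum = (L.map fun t => genForm Γ (triMon t)).sum := by
  simp only [genForm, map_list_sum, List.map_map]
  rfl

/-- The tangent coefficient of a sum of monomials. -/
def tanL (L : List Tri) (r s : Fin 4) (m : Tri) : ℤ := (L.map fun t => tan1 r s t m).sum

theorem tan_list {k : ℕ} (r s : Fin k → Fin 4) (j : Fin k) (L : List Tri) (m : Tri) :
    eval 0 (pderiv j (coeff (triExp m) (genForm (slice r s) (L.map triMon).sum))) =
      (tanL L (r j) (s j) m : ℂ) := by
  rw [genForm_list, tanL]
  induction L with
  | nil => simp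
  | cons t L ih =>
    simp only [List.map_cons, List.sum_cons, coeff_add, map_add, Int.cast_add, ih, tan_triMon]

theorem dim_orbit {k : ℕ} (r s : Fin k → Fin 4) (hrs : Function.Injective fun j => (r j, s j))
    (L : List Tri) (fn : Fin k → List (ℤ × Tri)) (d : Fin k → ℤ) (hd : ∀ i, d i ≠ 0)
    (hfn : ∀ i j, ((fn i).map fun q => q.1 * tanL L (r j) (s j) q.2).sum = if i = j then d i else 0)
    (h : MvPolynomial (Fin 4 × Fin 4) ℂ) (h0 : h ≠ 0)
    (hh : ∀ g : Matrix (Fin 4) (Fin 4) ℂ, eval (fun q => g q.1 q.2) h ≠ 0 →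
      ∃ M : Matrix (Fin 4) (Fin 4) ℂ, substMat g (L.map triMon).sum = substMat M (L.map triMon).sum ∧
      ∀ i l, (∀ j, (i, l) ≠ (r j, s j)) → M i l = (1 : Matrix (Fin 4) (Fin 4) ℂ) i l) :
    letI := zariskiTop (Fin 4 →₀ ℕ)
    topologicalKrullDim ↥(closure (coeffFn '' orbitSet (L.map triMon).sum)) = (k : ℕ∞) := by
  have hcl := closure_orbit_eq (slice r s) (L.map triMon).sum (slice_zero r s) h h0 (by
    intro g hg
    obtain ⟨M, hM, hM'⟩ := hh g hg
    obtain ⟨p, hp⟩ := slice_surj r s hrs M hM'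
    exact ⟨p, by rw [hp, hM]⟩)
  rw [hcl]
  let c := fun m => coeff m (genForm (slice r s) (L.map triMon).sum)
  apply dim_param c
  · apply Set.Finite.subset (((genForm (slice r s) (L.map triMon).sum).support.finite_toSet.image c).union
      (Set.finite_singleton 0))
    rintro _ ⟨m, rfl⟩
    by_cases hm : m ∈ (genForm (slice r s) (L.map triMon).sum).support
    · exact Or.inl ⟨m, hm, rfl⟩
    · exact Or.inr (notMem_support_iff.1 hm)
  · refine trdeg_adjoin_of_jac c (fun i => ((fn i).map fun q => C (q.1 : ℂ) * c (triExp q.2)).sum)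
      ?_ (fun i => (d i : ℂ)) (fun i => Int.cast_ne_zero.2 (hd i)) ?_
    · intro i
      apply Subalgebra.list_sum_mem
      intro x hx
      obtain ⟨q, -, rfl⟩ := List.mem_map.1 hx
      exact mul_mem (Subalgebra.algebraMap_mem _ _) (Algebra.subset_adjoin ⟨_, rfl⟩)
    · intro i j
      have h1 := congrArg (Int.cast : ℤ → ℂ) (hfn i j)
      rw [apply_ite (Int.cast : ℤ → ℂ), Int.cast_zero] at h1
      rw [← h1]
      generalize fn i = l
      induction l with
      | nil => simp
      | cons q l ih =>
        simp only [List.map_cons, List.sum_cons, map_add, Int.cast_add, ih, pderiv_C_mul,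
          Int.cast_mul, smul_eq_mul, map_mul, eval_C, c, smul_eval, tan_list]

theorem linForm_add {n : ℕ} (a b : Fin n → ℂ) : linForm (a + b) = linForm a + linForm b := by
  simp [linForm, add_mul, Finset.sum_add_distrib]

theorem linForm_smul {n : ℕ} (t : ℂ) (a : Fin n → ℂ) : linForm (t • a) = C t * linForm a := by
  simp [linForm, Finset.mul_sum, mul_assoc]

theorem substMat_X {n : ℕ} (g : Fin n → Fin n → ℂ) (i : Fin n) :
    substMat (Matrix.of g) (X i) = linForm (g i) := by
  simp [substMat, linForm]

theorem f2_list : (([(0, 1, 1), (2, 3, 3)] : List Tri).map triMon).sum =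
    (X 0 * X 1 ^ 2 + X 2 * X 3 ^ 2 : MvPolynomial (Fin 4) ℂ) := by
  simp [triMon]; ring

theorem f1_list : (([(0, 0, 1), (0, 2, 3), (2, 2, 2)] : List Tri).map triMon).sum =
    (X 0 ^ 2 * X 1 + X 0 * X 2 * X 3 + X 2 ^ 3 : MvPolynomial (Fin 4) ℂ) := by
  simp [triMon]; ring

theorem dim_f2 : letI := zariskiTop (Fin 4 →₀ ℕ)
    topologicalKrullDim ↥(closure (coeffFn '' orbitSet
      (X 0 * X 1 ^ 2 + X 2 * X 3 ^ 2 : MvPolynomial (Fin 4) ℂ))) = (14 : ℕ∞) := by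
  have := dim_orbit (k := 14) ![0, 0, 0, 0, 1, 1, 1, 2, 2, 2, 2, 3, 3, 3]
    ![0, 1, 2, 3, 0, 2, 3, 0, 1, 2, 3, 0, 1, 2] (by decide) [(0, 1, 1), (2, 3, 3)]
    ![[(1, 0, 1, 1)], [(1, 1, 1, 1)], [(1, 1, 1, 2)], [(1, 1, 1, 3)],
      [(1, 0, 0, 1)], [(1, 0, 1, 2)], [(1, 0, 1, 3)],
      [(1, 0, 3, 3)], [(1, 1, 3, 3)], [(1, 2, 3, 3)], [(1, 3, 3, 3)],
      [(1, 0, 2, 3)], [(1, 1, 2, 3)], [(1, 2, 2, 3)]]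
    ![1, 1, 1, 1, 2, 2, 2, 1, 1, 1, 1, 2, 2, 2] (by decide) (by decide +kernel)
    (X (1, 1) * X (3, 3)) (mul_ne_zero (X_ne_zero _) (X_ne_zero _)) (by
      intro g' hg
      obtain ⟨g, hgg⟩ : ∃ g : Fin 4 → Fin 4 → ℂ, g' = Matrix.of g := ⟨g', rfl⟩
      rw [hgg] at hg ⊢
      have hg' : g 1 1 ≠ 0 ∧ g 3 3 ≠ 0 := by simpa using hg
      obtain ⟨h1, h3⟩ := hg'
      refine ⟨Matrix.of ![(g 1 1) ^ 2 • g 0, (g 1 1)⁻¹ • g 1, (g 3 3) ^ 2 • g 2, (g 3 3)⁻¹ • g 3], ?_, ?_⟩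
      · rw [f2_list]
        simp only [map_add, map_mul, map_pow, substMat_X]
        simp only [Matrix.cons_val, linForm_smul, map_pow]
        have e1 : (C (g 1 1) * C (g 1 1)⁻¹ : MvPolynomial (Fin 4) ℂ) = 1 := by
          rw [← C_mul, mul_inv_cancel₀ h1, C_1]
        have e3 : (C (g 3 3) * C (g 3 3)⁻¹ : MvPolynomial (Fin 4) ℂ) = 1 := by
          rw [← C_mul, mul_inv_cancel₀ h3, C_1]
        calc _ = 1 ^ 2 * linForm (g 0) * linForm (g 1) ^ 2 + 1 ^ 2 * linForm (g 2) * linForm (g 3) ^ 2 := by ring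
          _ = _ := by
            nth_rw 1 [← e1]
            rw [← e3]; ring
      · intro i l hil
        have : (i, l) = (1, 1) ∨ (i, l) = (3, 3) := by revert i l; decide
        rcases this with h | h <;> obtain ⟨rfl, rfl⟩ := Prod.mk.inj h
        · simp [h1]
        · simp [h3])
  rw [f2_list] at this
  exact this

theorem dim_f1 : letI := zariskiTop (Fin 4 →₀ ℕ)
    topologicalKrullDim ↥(closure (coeffFn '' orbitSet
      (X 0 ^ 2 * X 1 + X 0 * X 2 * X 3 + X 2 ^ 3 : MvPolynomial (Fin 4) ℂ))) = (13 : ℕ∞) := by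
  have := dim_orbit (k := 13) ![0, 0, 0, 1, 1, 1, 1, 2, 2, 2, 3, 3, 3]
    ![1, 2, 3, 0, 1, 2, 3, 1, 2, 3, 1, 2, 3] (by decide) [(0, 0, 1), (0, 2, 3), (2, 2, 2)]
    ![[(1, 0, 1, 1)], [(1, 2, 2, 3), (-3, 0, 3, 3)], [(1, 2, 3, 3)],
      [(1, 0, 0, 0)], [(1, 0, 0, 1)], [(1, 0, 0, 2)], [(1, 0, 0, 3)],
      [(1, 1, 2, 2)], [(1, 2, 2, 2)], [(1, 0, 3, 3)],
      [(1, 0, 1, 2), (-2, 2, 2, 3), (6, 0, 3, 3)], [(1, 0, 2, 2)], [(3, 0, 2, 3), (-1, 2, 2, 2)]]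
    ![2, 1, 1, 1, 1, 1, 1, 3, 3, 1, 1, 1, 3] (by decide) (by decide +kernel)
    (X (0, 0)) (X_ne_zero _) (by
      intro g' hg
      obtain ⟨g, hgg⟩ : ∃ g : Fin 4 → Fin 4 → ℂ, g' = Matrix.of g := ⟨g', rfl⟩
      rw [hgg] at hg ⊢
      have h0 : g 0 0 ≠ 0 := by simpa using hg
      set t := g 0 0 with ht
      let m0 := t⁻¹ • g 0
      let m1 := t ^ 2 • g 1
      let m2 := g 2
      let m3 := t • g 3
      let u := m2 0
      let m2' := m2 + (-u) • m0
      let m3' := m3 + (3 * u) • m2'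
      let m1' := m1 + u • m3 + (3 * u ^ 2) • m2' + (u ^ 3) • m0
      let s := m3' 0
      let m3'' := m3' + (-s) • m0
      let m1'' := m1' + s • m2'
      refine ⟨Matrix.of ![m0, m1'', m2', m3''], ?_, ?_⟩
      · rw [f1_list]
        simp only [map_add, map_mul, map_pow, substMat_X]
        simp only [Matrix.cons_val, m1'', m1', m3'', m3', m2', m3, m2, m1, m0]
        generalize s = s
        generalize u = u
        simp only [linForm_smul, linForm_add, map_pow, map_mul, map_neg]
        have e1 : (C t * C t⁻¹ : MvPolynomial (Fin 4) ℂ) = 1 := by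
          rw [← C_mul, mul_inv_cancel₀ h0, C_1]
        have e3 : (C 3 : MvPolynomial (Fin 4) ℂ) = 3 := rfl
        rw [e3]
        generalize linForm (g 0) = L0
        generalize linForm (g 1) = L1
        generalize linForm (g 2) = L2
        generalize linForm (g 3) = L3
        generalize (C t : MvPolynomial (Fin 4) ℂ) = T at *
        generalize (C t⁻¹ : MvPolynomial (Fin 4) ℂ) = T' at *
        generalize (C u : MvPolynomial (Fin 4) ℂ) = U at *
        generalize (C s : MvPolynomial (Fin 4) ℂ) = S at *
        have e4 : T ^ 2 * T' ^ 2 = 1 := by rw [← mul_pow, e1, one_pow]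
        linear_combination (-L0 * L2 * L3) * e1 - L0 ^ 2 * L1 * e4
      · have hm0 : m0 0 = 1 := by simp [m0, ← ht, h0]
        have hm2 : m2' 0 = 0 := by simp [m2', u, hm0]
        have hm3 : m3'' 0 = 0 := by simp [m3'', s, hm0]
        intro i l hil
        have : (i, l) = (0, 0) ∨ (i, l) = (2, 0) ∨ (i, l) = (3, 0) := by revert i l; decide
        rcases this with h | h | h <;> obtain ⟨rfl, rfl⟩ := Prod.mk.inj h
        · simpa using hm0
        · simpa using hm2
        · simpa using hm3)
  rw [f1_list] at this
  exact this

theorem eval_linForm {n : ℕ} (c v : Fin n → ℂ) : eval v (linForm c) = c ⬝ᵥ v := by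
  simp [linForm, dotProduct]

/-- `f` is a sum of `r` cubes of linear forms. -/
def IsWaring (f : MvPolynomial (Fin 4) ℂ) (r : ℕ) : Prop :=
  ∃ l : Fin r → (Fin 4 → ℂ), f = ∑ i, linForm (l i) ^ 3

theorem IsWaring.succ {f : MvPolynomial (Fin 4) ℂ} {r : ℕ} (h : IsWaring f r) :
    IsWaring f (r + 1) := by
  obtain ⟨l, rfl⟩ := h
  refine ⟨Fin.cons 0 l, ?_⟩
  rw [Fin.sum_univ_succ]
  simp [linForm]

theorem IsWaring.mono {f : MvPolynomial (Fin 4) ℂ} {r n : ℕ} (h : IsWaring f r) (hn : r ≤ n) :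
    IsWaring f n := by
  induction n, hn using Nat.le_induction with
  | base => exact h
  | succ n _ ih => exact ih.succ

theorem IsWaring.of_smul {f : MvPolynomial (Fin 4) ℂ} {r : ℕ} (a : Fin r → ℂ)
    (l : Fin r → Fin 4 → ℂ) (h : f = ∑ i, C (a i) * linForm (l i) ^ 3) : IsWaring f r := by
  choose b hb using fun i => IsAlgClosed.exists_pow_nat_eq (a i) (n := 3) (by norm_num)
  refine ⟨fun i => b i • l i, ?_⟩
  rw [h]
  refine Finset.sum_congr rfl fun i _ => ?_
  rw [linForm_smul, mul_pow, ← C_pow, hb]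

theorem substMat_linForm (g : Matrix (Fin 4) (Fin 4) ℂ) (c : Fin 4 → ℂ) :
    substMat g (linForm c) = linForm (Matrix.vecMul c g) := by
  apply MvPolynomial.funext
  intro v
  rw [eval_linForm, ← Matrix.dotProduct_mulVec]
  simp [substMat, linForm, dotProduct, Matrix.mulVec]

theorem IsWaring.subst {f : MvPolynomial (Fin 4) ℂ} {r : ℕ} (h : IsWaring f r)
    (g : Matrix (Fin 4) (Fin 4) ℂ) : IsWaring (substMat g f) r := by
  obtain ⟨l, rfl⟩ := h
  exact ⟨fun i => Matrix.vecMul (l i) g, by simp only [map_sum, map_pow, substMat_linForm]⟩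

theorem substMat_inv (g : Matrix (Fin 4) (Fin 4) ℂ) (hg : IsUnit g.det)
    (f : MvPolynomial (Fin 4) ℂ) : substMat g⁻¹ (substMat g f) = f := by
  have : (substMat g⁻¹).comp (substMat g) = AlgHom.id ℂ _ := by
    apply MvPolynomial.algHom_ext
    intro i
    have e : (X i : MvPolynomial (Fin 4) ℂ) = linForm (Pi.single i 1) := by
      apply MvPolynomial.funext
      intro v
      rw [eval_linForm]; simp
    rw [AlgHom.comp_apply, e, substMat_linForm, substMat_linForm, Matrix.vecMul_vecMul,
      Matrix.mul_nonsing_inv _ hg, Matrix.vecMul_one]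
    rfl
  exact AlgHom.congr_fun this f

theorem waringRank_subst (g : Matrix (Fin 4) (Fin 4) ℂ) (f : MvPolynomial (Fin 4) ℂ)
    (hg : IsUnit g.det) : waringRank (substMat g f) = waringRank f := by
  unfold waringRank
  congr 1
  ext r
  constructor
  · intro h
    have := IsWaring.subst (f := substMat g f) (r := r) h g⁻¹
    rwa [substMat_inv g hg] at this
  · intro h
    exact IsWaring.subst (f := f) (r := r) h g

theorem waringRank_eq {f : MvPolynomial (Fin 4) ℂ} {n : ℕ} (h : IsWaring f (n + 1))
    (h' : ¬ IsWaring f n) : waringRank f = n + 1 := by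
  apply le_antisymm
  · exact Nat.sInf_le h
  · refine le_csInf ⟨_, h⟩ fun r hr => ?_
    by_contra hlt
    exact h' (IsWaring.mono (f := f) (r := r) hr (by omega))

theorem waring_f2 : IsWaring (X 0 * X 1 ^ 2 + X 2 * X 3 ^ 2) 6 := by
  apply IsWaring.of_smul ![1 / 6, 1 / 6, -1 / 3, 1 / 6, 1 / 6, -1 / 3]
    ![![1, 1, 0, 0], ![1, -1, 0, 0], ![1, 0, 0, 0], ![0, 0, 1, 1], ![0, 0, 1, -1], ![0, 0, 1, 0]]
  apply MvPolynomial.funext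
  intro v
  simp only [map_add, map_mul, map_pow, eval_X, map_sum, eval_C, eval_linForm, dotProduct]
  simp [Fin.sum_univ_succ]
  ring

theorem waring_f1 : IsWaring (X 0 ^ 2 * X 1 + X 0 * X 2 * X 3 + X 2 ^ 3) 7 := by
  apply IsWaring.of_smul ![-1 / 6, 3 / 6, -3 / 6, 1 / 6, 1 / 6, 1 / 6, -1 / 3]
    ![![0, 0, -3 / 2, 1], ![-1 / 3, 0, -1 / 2, 1], ![-1 / 3, 0, 1 / 2, 1], ![0, 0, 3 / 2, 1],
      ![1, 1, 1 / 6, 0], ![-1, 1, 1 / 6, 0], ![0, 1, 1 / 6, 0]]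
  apply MvPolynomial.funext
  intro v
  simp only [map_add, map_mul, map_pow, eval_X, map_sum, eval_C, eval_linForm, dotProduct]
  simp [Fin.sum_univ_succ]
  ring

theorem polar {r : ℕ} (l : Fin r → Fin 4 → ℂ) (φ : (Fin 4 → ℂ) → ℂ)
    (h : ∀ v, φ v = ∑ i, (l i ⬝ᵥ v) ^ 3) (u v w : Fin 4 → ℂ) :
    6 * ∑ i, (l i ⬝ᵥ u) * (l i ⬝ᵥ v) * (l i ⬝ᵥ w) =
      φ (u + v + w) - φ (u + v) - φ (u + w) - φ (v + w) + φ u + φ v + φ w := by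
  simp only [h, ← Finset.sum_sub_distrib, ← Finset.sum_add_distrib, Finset.mul_sum, dotProduct_add]
  exact Finset.sum_congr rfl fun i _ => by ring

theorem polar_f1 {r : ℕ} (l : Fin r → Fin 4 → ℂ)
    (h : X 0 ^ 2 * X 1 + X 0 * X 2 * X 3 + X 2 ^ 3 = ∑ i, linForm (l i) ^ 3) (u v w : Fin 4 → ℂ) :
    6 * ∑ i, (l i ⬝ᵥ u) * (l i ⬝ᵥ v) * (l i ⬝ᵥ w) =
      2 * (u 0 * v 0 * w 1 + u 0 * v 1 * w 0 + u 1 * v 0 * w 0) +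
      (u 0 * v 2 * w 3 + u 0 * v 3 * w 2 + u 2 * v 0 * w 3 + u 2 * v 3 * w 0 + u 3 * v 0 * w 2
        + u 3 * v 2 * w 0) + 6 * (u 2 * v 2 * w 2) := by
  rw [polar l (fun v => v 0 ^ 2 * v 1 + v 0 * v 2 * v 3 + v 2 ^ 3)]
  · simp only [Pi.add_apply]; ring
  · intro v
    have := congrArg (eval v) h
    simpa [eval_linForm] using this

theorem polar_f2 {r : ℕ} (l : Fin r → Fin 4 → ℂ)
    (h : X 0 * X 1 ^ 2 + X 2 * X 3 ^ 2 = ∑ i, linForm (l i) ^ 3) (u v w : Fin 4 → ℂ) :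
    6 * ∑ i, (l i ⬝ᵥ u) * (l i ⬝ᵥ v) * (l i ⬝ᵥ w) =
      2 * (u 0 * v 1 * w 1 + u 1 * v 0 * w 1 + u 1 * v 1 * w 0) +
      2 * (u 2 * v 3 * w 3 + u 3 * v 2 * w 3 + u 3 * v 3 * w 2) := by
  rw [polar l (fun v => v 0 * v 1 ^ 2 + v 2 * v 3 ^ 2)]
  · simp only [Pi.add_apply]; ring
  · intro v
    have := congrArg (eval v) h
    simpa [eval_linForm] using this

/-- Linear relations between the linear forms `l i`. -/
noncomputable def relMod {r : ℕ} (l : Fin r → Fin 4 → ℂ) : Submodule ℂ (Fin r → ℂ) :=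
  LinearMap.ker (Matrix.mulVecLin (Matrix.of l).transpose)

theorem mem_relMod {r : ℕ} (l : Fin r → Fin 4 → ℂ) (c : Fin r → ℂ)
    (h : ∀ w, ∑ i, c i * (l i ⬝ᵥ w) = 0) : c ∈ relMod l := by
  rw [relMod, LinearMap.mem_ker]
  ext j
  have := h (Pi.single j 1)
  simpa [Matrix.vecMul, dotProduct, mul_comm, Pi.single_apply] using this

theorem finrank_relMod {r : ℕ} (l : Fin r → Fin 4 → ℂ)
    (h : ∀ v, (∀ i, l i ⬝ᵥ v = 0) → v = 0) : Module.finrank ℂ (relMod l) + 4 = r := by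
  have h1 : (Matrix.of l).rank = 4 := by
    rw [Matrix.rank, LinearMap.finrank_range_of_inj]
    · simp
    · rw [← LinearMap.ker_eq_bot, LinearMap.ker_eq_bot']
      intro v hv
      exact h v fun i => congrFun hv i
  rw [← Matrix.rank_transpose, Matrix.rank] at h1
  have h2 := LinearMap.finrank_range_add_finrank_ker (Matrix.mulVecLin (Matrix.of l).transpose)
  rw [h1, Module.finrank_fin_fun] at h2
  rw [relMod]; omega

theorem not_waring_f2 : ¬ IsWaring (X 0 * X 1 ^ 2 + X 2 * X 3 ^ 2) 5 := by
  rintro ⟨l, hl⟩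
  have hT := polar_f2 l hl
  have hinj : ∀ v, (∀ i, l i ⬝ᵥ v = 0) → v = 0 := by
    intro v hv
    have hz : ∀ u w : Fin 4 → ℂ, (0 : ℂ) = 2 * (u 0 * v 1 * w 1 + u 1 * v 0 * w 1 + u 1 * v 1 * w 0) +
      2 * (u 2 * v 3 * w 3 + u 3 * v 2 * w 3 + u 3 * v 3 * w 2) := by
      intro u w
      rw [← hT u v w]; simp [hv]
    have h1 := hz ![1, 0, 0, 0] ![0, 1, 0, 0]
    have h0 := hz ![0, 1, 0, 0] ![0, 1, 0, 0]
    have h3 := hz ![0, 0, 1, 0] ![0, 0, 0, 1]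
    have h2 := hz ![0, 0, 0, 1] ![0, 0, 0, 1]
    simp at h0 h1 h2 h3
    ext i; fin_cases i <;> simp [h0, h1, h2, h3]
  have hr : Module.finrank ℂ (relMod l) = 1 := by
    have := finrank_relMod l hinj; omega
  have hq : ∀ s u : ℂ, (fun i => (l i ⬝ᵥ ![s, 0, u, 0]) * (l i ⬝ᵥ ![s, 0, u, 0])) ∈ relMod l := by
    intro s u
    apply mem_relMod
    intro w
    have := hT ![s, 0, u, 0] ![s, 0, u, 0] w
    simpa using this
  obtain ⟨c, hc0, hc⟩ := finrank_eq_one_iff'.1 hr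
  obtain ⟨i0, hi0⟩ : ∃ i, c.1 i ≠ 0 := by
    by_contra hcon
    push Not at hcon
    exact hc0 (Subtype.ext (funext hcon))
  obtain ⟨s, u, hsu, hne⟩ : ∃ s u : ℂ, l i0 ⬝ᵥ ![s, 0, u, 0] = 0 ∧ ¬ (s = 0 ∧ u = 0) := by
    by_cases h0 : l i0 0 = 0
    · exact ⟨1, 0, by simp [dotProduct, Fin.sum_univ_succ, h0], by simp⟩
    · exact ⟨l i0 2, - l i0 0, by simp [dotProduct, Fin.sum_univ_succ]; ring, by simp [h0]⟩
  obtain ⟨t, ht⟩ := hc ⟨_, hq s u⟩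
  have ht' : ∀ i, t * c.1 i = (l i ⬝ᵥ ![s, 0, u, 0]) * (l i ⬝ᵥ ![s, 0, u, 0]) := fun i =>
    congrFun (congrArg Subtype.val ht) i
  have t0 : t = 0 := by
    have := ht' i0
    rw [hsu, mul_zero] at this
    exact (mul_eq_zero.1 this).resolve_right hi0
  have := hinj ![s, 0, u, 0] fun i => by
    have := ht' i
    rw [t0, zero_mul] at this
    exact mul_self_eq_zero.1 this.symm
  apply hne
  exact ⟨by simpa using congrFun this 0, by simpa using congrFun this 2⟩

theorem card_supp {d r : ℕ} (l : Fin r → Fin 4 → ℂ) (v : Fin 4 → ℂ) (hv : ∃ i, l i ⬝ᵥ v ≠ 0)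
    (ε : (Fin d → ℂ) →ₗ[ℂ] (Fin 4 → ℂ))
    (horth : ∀ x, ∑ i, (l i ⬝ᵥ v) * (l i ⬝ᵥ v) * (l i ⬝ᵥ ε x) = 0)
    (hk : ∀ x, (∀ w, ∑ i, (l i ⬝ᵥ v) * (l i ⬝ᵥ ε x) * (l i ⬝ᵥ w) = 0) → ∃ t : ℂ, ε x = t • v)
    (hinj : ∀ x, ε x = 0 → x = 0) :
    d + 1 ≤ (Finset.univ.filter fun i => l i ⬝ᵥ v ≠ 0).card := by
  obtain ⟨i0, hi0⟩ := hv
  set A := Finset.univ.filter fun i => l i ⬝ᵥ v ≠ 0 with hA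
  have hmem : i0 ∈ A := by simp [hA, hi0]
  let ψ : (Fin d → ℂ) →ₗ[ℂ] ({i // i ∈ A.erase i0} → ℂ) :=
    LinearMap.pi fun i => (Matrix.mulVecLin (Matrix.of l)).comp ε |> (LinearMap.proj i.1).comp
  have hψ : ∀ x i, ψ x i = l i.1 ⬝ᵥ ε x := fun x i => rfl
  have hψi : Function.Injective ψ := by
    rw [← LinearMap.ker_eq_bot, LinearMap.ker_eq_bot']
    intro x hx
    have h1 : ∀ i, i ≠ i0 → l i ⬝ᵥ v = 0 ∨ l i ⬝ᵥ ε x = 0 := by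
      intro i hi
      by_cases h : l i ⬝ᵥ v = 0
      · exact Or.inl h
      · exact Or.inr (congrFun hx ⟨i, by simp [hA, hi, h]⟩)
    have h2 : l i0 ⬝ᵥ ε x = 0 := by
      have := horth x
      rw [Finset.sum_eq_single i0] at this
      · simpa [hi0] using this
      · intro i _ hi
        rcases h1 i hi with h | h <;> rw [h] <;> ring
      · simp
    have h3 : ∀ i, (l i ⬝ᵥ v) * (l i ⬝ᵥ ε x) = 0 := by
      intro i
      by_cases hi : i = i0
      · rw [hi, h2, mul_zero]
      · exact mul_eq_zero.2 (h1 i hi)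
    obtain ⟨t, ht⟩ := hk x fun w => Finset.sum_eq_zero fun i _ => by rw [h3, zero_mul]
    apply hinj
    rw [ht, dotProduct_smul, smul_eq_mul] at h2
    rw [ht, (mul_eq_zero.1 h2).resolve_right hi0, zero_smul]
  have := LinearMap.finrank_le_finrank_of_injective hψi
  rw [Module.finrank_fin_fun, Module.finrank_fintype_fun_eq_card, Fintype.card_coe,
    Finset.card_erase_of_mem hmem] at this
  have := Finset.card_pos.2 ⟨_, hmem⟩
  omega

theorem binary_factor (A B D : ℂ) (h : ¬ (A = 0 ∧ B = 0 ∧ D = 0)) :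
    ∃ p q p' q' : ℂ, ¬ (p = 0 ∧ q = 0) ∧ ¬ (p' = 0 ∧ q' = 0) ∧
      ∀ x y, A * (x * x) + B * (x * y) + D * (y * y) = (p * x + q * y) * (p' * x + q' * y) := by
  by_cases hA : A = 0
  · subst hA
    refine ⟨0, 1, B, D, by simp, fun h' => h ⟨rfl, h'⟩, fun x y => by ring⟩
  · obtain ⟨z, hz⟩ := IsAlgClosed.exists_pow_nat_eq (B ^ 2 - 4 * A * D) (n := 2) (by norm_num)
    refine ⟨A, (B - z) / 2, 1, (B + z) / (2 * A), by simp [hA], by simp, fun x y => ?_⟩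
    field_simp
    linear_combination (y ^ 2) * hz

theorem not_waring_f1 : ¬ IsWaring (X 0 ^ 2 * X 1 + X 0 * X 2 * X 3 + X 2 ^ 3) 6 := by
  rintro ⟨l, hl⟩
  have hT := polar_f1 l hl
  have hinj : ∀ v, (∀ i, l i ⬝ᵥ v = 0) → v = 0 := by
    intro v hv
    have hz : ∀ u w : Fin 4 → ℂ, (0 : ℂ) = 2 * (u 0 * v 0 * w 1 + u 0 * v 1 * w 0 + u 1 * v 0 * w 0) +
      (u 0 * v 2 * w 3 + u 0 * v 3 * w 2 + u 2 * v 0 * w 3 + u 2 * v 3 * w 0 + u 3 * v 0 * w 2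
        + u 3 * v 2 * w 0) + 6 * (u 2 * v 2 * w 2) := by
      intro u w
      rw [← hT u v w]; simp [hv]
    have h0 := hz ![1, 0, 0, 0] ![0, 1, 0, 0]
    have h1 := hz ![1, 0, 0, 0] ![1, 0, 0, 0]
    have h3 := hz ![1, 0, 0, 0] ![0, 0, 1, 0]
    have h2 := hz ![1, 0, 0, 0] ![0, 0, 0, 1]
    simp at h0 h1 h2 h3
    ext i; fin_cases i <;> simp [h0, h1, ← h2, ← h3]
  have hr : Module.finrank ℂ (relMod l) = 2 := by
    have := finrank_relMod l hinj; omega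
  have hq : ∀ p q p' q' : ℂ,
      (fun i => (l i ⬝ᵥ ![0, p, 0, q]) * (l i ⬝ᵥ ![0, p', 0, q'])) ∈ relMod l := by
    intro p q p' q'
    apply mem_relMod
    intro w
    have := hT ![0, p, 0, q] ![0, p', 0, q'] w
    simpa using this
  have hlin : ∀ i (p q : ℂ), l i ⬝ᵥ ![0, p, 0, q] = p * l i 1 + q * l i 3 := by
    intro i p q
    simp [dotProduct, Fin.sum_univ_succ]; ring
  obtain ⟨A, B, D, hABD, hz⟩ : ∃ A B D : ℂ, ¬ (A = 0 ∧ B = 0 ∧ D = 0) ∧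
      ∀ i, A * (l i 1 * l i 1) + B * (l i 1 * l i 3) + D * (l i 3 * l i 3) = 0 := by
    let Q : Fin 3 → relMod l := ![⟨_, hq 1 0 1 0⟩, ⟨_, hq 1 0 0 1⟩, ⟨_, hq 0 1 0 1⟩]
    have hdep : ¬ LinearIndependent ℂ Q := by
      intro hli
      have := hli.fintype_card_le_finrank
      rw [hr] at this
      simp at this
    obtain ⟨a, ha, k, hk⟩ := Fintype.not_linearIndependent_iff.1 hdep
    refine ⟨a 0, a 1, a 2, ?_, ?_⟩
    · rintro ⟨h0, h1, h2⟩
      apply hk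
      fin_cases k
      exacts [h0, h1, h2]
    · intro i
      have := congrFun (congrArg Subtype.val ha) i
      simp only [Fin.sum_univ_three, Q] at this
      simp [hlin] at this
      linear_combination this
  obtain ⟨p, q, p', q', hpq, hpq', hf⟩ := binary_factor A B D hABD
  have hprod : ∀ i, (l i ⬝ᵥ ![0, p, 0, q]) * (l i ⬝ᵥ ![0, p', 0, q']) = 0 := by
    intro i
    rw [hlin, hlin, ← hf, hz]
  have hne : ∀ p q : ℂ, ¬ (p = 0 ∧ q = 0) → ∃ i, l i ⬝ᵥ ![0, p, 0, q] ≠ 0 := by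
    intro p q h
    by_contra hcon
    push Not at hcon
    have := hinj _ hcon
    exact h ⟨by simpa using congrFun this 1, by simpa using congrFun this 3⟩
  have hcard3 : ∀ p q : ℂ, ¬ (p = 0 ∧ q = 0) →
      3 ≤ (Finset.univ.filter fun i => l i ⬝ᵥ ![0, p, 0, q] ≠ 0).card := by
    intro p q h
    have hε : ∀ x : Fin 2 → ℂ, Matrix.mulVecLin !![0, 1; p, 0; 0, 0; q, 0] x =
        ![x 1, p * x 0, 0, q * x 0] := by
      intro x
      ext i; fin_cases i <;> simp [Matrix.mulVec, dotProduct, Fin.sum_univ_succ]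
    apply card_supp l ![0, p, 0, q] (hne p q h) (Matrix.mulVecLin !![0, 1; p, 0; 0, 0; q, 0])
    · intro x
      have := hT ![0, p, 0, q] ![0, p, 0, q] (Matrix.mulVecLin !![0, 1; p, 0; 0, 0; q, 0] x)
      simpa using this
    · intro x hx
      simp only [hε] at hx ⊢
      have h0 := hT ![0, p, 0, q] ![x 1, p * x 0, 0, q * x 0] ![1, 0, 0, 0]
      have h2 := hT ![0, p, 0, q] ![x 1, p * x 0, 0, q * x 0] ![0, 0, 1, 0]
      rw [hx] at h0 h2
      simp at h0 h2
      have hx1 : x 1 = 0 := by tauto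
      exact ⟨x 0, by ext i; fin_cases i <;> simp [hx1, mul_comm]⟩
    · intro x hx
      rw [hε] at hx
      have h0 : x 1 = 0 := by simpa using congrFun hx 0
      have h1 : p = 0 ∨ x 0 = 0 := by simpa using congrFun hx 1
      have h3 : q = 0 ∨ x 0 = 0 := by simpa using congrFun hx 3
      have : x 0 = 0 := by tauto
      ext i; fin_cases i <;> simp [h0, this]
  have hcard4 : ∀ p q : ℂ, q ≠ 0 →
      4 ≤ (Finset.univ.filter fun i => l i ⬝ᵥ ![0, p, 0, q] ≠ 0).card := by
    intro p q h
    have hε : ∀ x : Fin 3 → ℂ, Matrix.mulVecLin !![0, 1, 0; p, 0, 0; 0, 0, 1; q, 0, 0] x =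
        ![x 1, p * x 0, x 2, q * x 0] := by
      intro x
      ext i; fin_cases i <;> simp [Matrix.mulVec, dotProduct, Fin.sum_univ_succ]
    apply card_supp l ![0, p, 0, q] (hne p q fun h' => h h'.2)
      (Matrix.mulVecLin !![0, 1, 0; p, 0, 0; 0, 0, 1; q, 0, 0])
    · intro x
      have := hT ![0, p, 0, q] ![0, p, 0, q]
        (Matrix.mulVecLin !![0, 1, 0; p, 0, 0; 0, 0, 1; q, 0, 0] x)
      simpa using this
    · intro x hx
      simp only [hε] at hx ⊢
      have h0 := hT ![0, p, 0, q] ![x 1, p * x 0, x 2, q * x 0] ![1, 0, 0, 0]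
      have h2 := hT ![0, p, 0, q] ![x 1, p * x 0, x 2, q * x 0] ![0, 0, 1, 0]
      rw [hx] at h0 h2
      simp [h] at h0 h2
      rw [h2] at h0
      simp [h] at h0
      exact ⟨x 0, by ext i; fin_cases i <;> simp [h2, h0, mul_comm]⟩
    · intro x hx
      rw [hε] at hx
      have h0 : x 1 = 0 := by simpa using congrFun hx 0
      have h2 : x 2 = 0 := by simpa using congrFun hx 2
      have h3 : x 0 = 0 := by simpa [h] using congrFun hx 3
      ext i; fin_cases i <;> simp [h0, h2, h3]
  have hdisj : Disjoint (Finset.univ.filter fun i => l i ⬝ᵥ ![0, p, 0, q] ≠ 0)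
      (Finset.univ.filter fun i => l i ⬝ᵥ ![0, p', 0, q'] ≠ 0) := by
    rw [Finset.disjoint_filter]
    intro i _ h1 h2
    exact (mul_ne_zero h1 h2) (hprod i)
  have hle := Finset.card_le_univ (Finset.disjUnion _ _ hdisj)
  rw [Finset.card_disjUnion, Fintype.card_fin] at hle
  have h3 := hcard3 p q hpq
  have h3' := hcard3 p' q' hpq'
  by_cases hq0 : q = 0
  · by_cases hq0' : q' = 0
    · have hp : p ≠ 0 := fun h => hpq ⟨h, hq0⟩
      have hp' : p' ≠ 0 := fun h => hpq' ⟨h, hq0'⟩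
      obtain ⟨i, hi⟩ := hne 1 0 (by simp)
      have := hprod i
      rw [hlin, hlin, hq0, hq0'] at this
      rw [hlin] at hi
      simp [hp, hp'] at this hi
      exact hi this
    · have := hcard4 p' q' hq0'
      omega
  · have := hcard4 p q hq0
    omega

theorem not_equiv_aux (g : Matrix (Fin 4) (Fin 4) ℂ) (c : ℂ) (hc : c ≠ 0)
    (h : substMat g (X 0 * X 1 ^ 2 + X 2 * X 3 ^ 2) =
      C c * (X 0 ^ 2 * X 1 + X 0 * X 2 * X 3 + X 2 ^ 3)) : False := by
  have h1 := waring_f2.subst g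
  rw [h] at h1
  obtain ⟨l, hl⟩ := h1
  apply not_waring_f1
  apply IsWaring.of_smul (fun _ => c⁻¹) l
  rw [← Finset.mul_sum, ← hl, ← mul_assoc, ← C_mul, inv_mul_cancel₀ hc, C_1, one_mul]

/-- The cubic surfaces `7B : x₁²x₂ + x₁x₃x₄ + x₃³` and `6C : x₁x₂² + x₃x₄²` are not
in the same `PGL(4,ℂ)`-orbit: there is no invertible change of coordinates carrying one
to a nonzero scalar multiple of the other.  Indeed their Waring ranks are `7` and `6`
respectively (and Waring rank is invariant under invertible linear change of
coordinates), and their orbit closures have dimensions `13` and `14` respectively. -/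
theorem sevenB_not_equivalent_sixC :
    let f₁ : MvPolynomial (Fin 4) ℂ := X 0 ^ 2 * X 1 + X 0 * X 2 * X 3 + X 2 ^ 3
    let f₂ : MvPolynomial (Fin 4) ℂ := X 0 * X 1 ^ 2 + X 2 * X 3 ^ 2
    (¬ ∃ (g : Matrix (Fin 4) (Fin 4) ℂ) (c : ℂ),
        IsUnit g.det ∧ c ≠ 0 ∧ substMat g f₂ = C c * f₁) ∧
    waringRank f₁ = 7 ∧ waringRank f₂ = 6 ∧
    (∀ (g : Matrix (Fin 4) (Fin 4) ℂ) (f : MvPolynomial (Fin 4) ℂ), IsUnit g.det →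
      waringRank (substMat g f) = waringRank f) ∧
    (letI := zariskiTop (Fin 4 →₀ ℕ);
      topologicalKrullDim ↥(closure (coeffFn '' orbitSet f₁)) = (13 : ℕ∞) ∧
      topologicalKrullDim ↥(closure (coeffFn '' orbitSet f₂)) = (14 : ℕ∞)) := by
  intro f₁ f₂
  refine ⟨?_, waringRank_eq waring_f1 not_waring_f1, waringRank_eq waring_f2 not_waring_f2,
    waringRank_subst, dim_f1, dim_f2⟩
  rintro ⟨g, c, -, hc, h⟩
  exact not_equiv_aux g c hc h
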